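/- Let u₀ < u₁, v₀ < v₁, set D = [u₀,u₁] × [v₀,v₁] \ {(u₁,v₁)} and let X = ({u₀} × [v₀,v₁]) ∪ ([u₀,u₁] × {v₀}). Suppose r, Ω, φ are C² on D with r > 0 and Ω > 0, satisfy equations (E1)–(C2) pointwise on D, that λ ≥ 0 and ν < 0 on D, and that V(x) ≥ -C for all x ∈ ℝ for some constant C ≥ 0. Suppose further that on the initial edges X the quantities r, 1/r, |ν|, λ, |φ|, |θ|, |ζ|, |m|, κ, |∂_u Ω|, |∂_v Ω|, |∂_u ν|, |∂_v λ| are bounded. Then the supremum over D of |Ω| + |Ω⁻¹| + |∂_u Ω| + |∂_v Ω| + r + r⁻¹ + |∂_u r| + |∂_v r| + |∂_u∂_u r| + |∂_v∂_v r| + |∂_u∂_v r| + |φ| + |∂_u φ| + |∂_v φ| is finite. -/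

import Mathlib

open Real Set MeasureTheory

/-- Partial derivative in the first (u) variable. -/
noncomputable def pu (f : ℝ → ℝ → ℝ) (u v : ℝ) : ℝ := deriv (fun x => f x v) u

/-- Partial derivative in the second (v) variable. -/
noncomputable def pv (f : ℝ → ℝ → ℝ) (u v : ℝ) : ℝ := deriv (fun y => f u y) v

/-- The Hawking mass m = (r/2)(1 + 4 Ω⁻² ν λ). -/
noncomputable def hawkingMass (r Ω : ℝ → ℝ → ℝ) (u v : ℝ) : ℝ :=
  r u v / 2 * (1 + 4 * pu r u v * pv r u v / (Ω u v) ^ 2)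

/-- κ = -Ω²/(4ν). -/
noncomputable def kappa (r Ω : ℝ → ℝ → ℝ) (u v : ℝ) : ℝ :=
  -(Ω u v) ^ 2 / (4 * pu r u v)

/-- (E1):  ∂_u∂_v r = -(1/r)∂_u r ∂_v r - Ω²/(4r) + (r/2)Ω² V(φ). -/
def eqE1 (r Ω φ : ℝ → ℝ → ℝ) (V : ℝ → ℝ) (u v : ℝ) : Prop :=
  pu (pv r) u v =
    -(1 / r u v) * pu r u v * pv r u v - (Ω u v) ^ 2 / (4 * r u v)
      + r u v / 2 * (Ω u v) ^ 2 * V (φ u v)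

/-- (E2):  ∂_u∂_v log Ω² = Ω²/(4r²) + r⁻²∂_u r ∂_v r - ∂_u φ ∂_v φ. -/
def eqE2 (r Ω φ : ℝ → ℝ → ℝ) (u v : ℝ) : Prop :=
  pu (pv (fun a b => Real.log ((Ω a b) ^ 2))) u v =
    (Ω u v) ^ 2 / (4 * (r u v) ^ 2) + pu r u v * pv r u v / (r u v) ^ 2
      - pu φ u v * pv φ u v

/-- (E3):  ∂_u∂_v φ = -r⁻¹∂_u φ ∂_v r - r⁻¹∂_v φ ∂_u r - (Ω²/4)V'(φ). -/
def eqE3 (r Ω φ : ℝ → ℝ → ℝ) (V : ℝ → ℝ) (u v : ℝ) : Prop :=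
  pu (pv φ) u v =
    -(pu φ u v * pv r u v) / r u v - (pv φ u v * pu r u v) / r u v
      - (Ω u v) ^ 2 / 4 * deriv V (φ u v)

/-- (C1):  ∂_u(Ω⁻²∂_u r) = -rΩ⁻²(∂_u φ)². -/
def eqC1 (r Ω φ : ℝ → ℝ → ℝ) (u v : ℝ) : Prop :=
  pu (fun a b => pu r a b / (Ω a b) ^ 2) u v =
    -(r u v) * (pu φ u v) ^ 2 / (Ω u v) ^ 2

/-- (C2):  ∂_v(Ω⁻²∂_v r) = -rΩ⁻²(∂_v φ)². -/
def eqC2 (r Ω φ : ℝ → ℝ → ℝ) (u v : ℝ) : Prop :=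
  pv (fun a b => pv r a b / (Ω a b) ^ 2) u v =
    -(r u v) * (pv φ u v) ^ 2 / (Ω u v) ^ 2

/-- `f` is bounded in absolute value on `s`. -/
def BddOn (s : Set (ℝ × ℝ)) (f : ℝ × ℝ → ℝ) : Prop := ∃ K, ∀ p ∈ s, |f p| ≤ K

namespace BddOn

variable {s t : Set (ℝ × ℝ)} {f g : ℝ × ℝ → ℝ}

theorem const (c : ℝ) : BddOn s fun _ => c := ⟨|c|, fun _ _ => le_rfl⟩

theorem add (hf : BddOn s f) (hg : BddOn s g) : BddOn s fun p => f p + g p := by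
  obtain ⟨K, hK⟩ := hf
  obtain ⟨L, hL⟩ := hg
  exact ⟨K + L, fun p hp => (abs_add_le _ _).trans (add_le_add (hK p hp) (hL p hp))⟩

theorem neg (hf : BddOn s f) : BddOn s fun p => -f p := by
  obtain ⟨K, hK⟩ := hf
  exact ⟨K, fun p hp => by simpa using hK p hp⟩

theorem sub (hf : BddOn s f) (hg : BddOn s g) : BddOn s fun p => f p - g p := by
  simpa only [sub_eq_add_neg] using hf.add hg.neg

theorem mul (hf : BddOn s f) (hg : BddOn s g) : BddOn s fun p => f p * g p := by
  obtain ⟨K, hK⟩ := hf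
  obtain ⟨L, hL⟩ := hg
  refine ⟨K * L, fun p hp => ?_⟩
  rw [abs_mul]
  exact mul_le_mul (hK p hp) (hL p hp) (abs_nonneg _) ((abs_nonneg _).trans (hK p hp))

theorem pow (hf : BddOn s f) (n : ℕ) : BddOn s fun p => f p ^ n := by
  obtain ⟨K, hK⟩ := hf
  refine ⟨K ^ n, fun p hp => ?_⟩
  rw [abs_pow]
  exact pow_le_pow_left₀ (abs_nonneg _) (hK p hp) n

theorem congr (hf : BddOn s f) (h : ∀ p ∈ s, g p = f p) : BddOn s g := by
  obtain ⟨K, hK⟩ := hf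
  exact ⟨K, fun p hp => h p hp ▸ hK p hp⟩

theorem mono_abs (hf : BddOn s f) (h : ∀ p ∈ s, |g p| ≤ |f p|) : BddOn s g := by
  obtain ⟨K, hK⟩ := hf
  exact ⟨K, fun p hp => (h p hp).trans (hK p hp)⟩

theorem abs (hf : BddOn s f) : BddOn s fun p => |f p| :=
  hf.mono_abs fun _ _ => (abs_abs _).le

theorem mono (hf : BddOn s f) (h : t ⊆ s) : BddOn t f := by
  obtain ⟨K, hK⟩ := hf
  exact ⟨K, fun p hp => hK p (h hp)⟩

theorem comp_continuous (hf : BddOn s f) {V : ℝ → ℝ} (hV : Continuous V) :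
    BddOn s fun p => V (f p) := by
  obtain ⟨K, hK⟩ := hf
  obtain ⟨L, hL⟩ := (isCompact_Icc (a := -K) (b := K)).exists_bound_of_continuousOn hV.continuousOn
  exact ⟨L, fun p hp => hL _ (abs_le.1 (hK p hp))⟩

theorem of_le_of_le (hf : ∃ K, ∀ p ∈ s, f p ≤ K) (hf' : ∃ K, ∀ p ∈ s, -f p ≤ K) : BddOn s f := by
  obtain ⟨K, hK⟩ := hf
  obtain ⟨L, hL⟩ := hf'
  refine ⟨max K L, fun p hp => abs_le'.2 ⟨?_, ?_⟩⟩
  · exact (hK p hp).trans (le_max_left _ _)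
  · exact (hL p hp).trans (le_max_right _ _)

theorem exists_le (hf : BddOn s f) : ∃ K, ∀ p ∈ s, f p ≤ K := by
  obtain ⟨K, hK⟩ := hf
  exact ⟨K, fun p hp => (le_abs_self _).trans (hK p hp)⟩

theorem exists_pos (hf : BddOn s f) : ∃ K, 0 < K ∧ ∀ p ∈ s, |f p| ≤ K := by
  obtain ⟨K, hK⟩ := hf
  exact ⟨max K 1, by positivity, fun p hp => (hK p hp).trans (le_max_left _ _)⟩

theorem of_nonneg_of_le (hf : ∀ p ∈ s, 0 ≤ f p) (h : ∃ K, ∀ p ∈ s, f p ≤ K) : BddOn s f := by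
  obtain ⟨K, hK⟩ := h
  exact ⟨K, fun p hp => by rw [abs_of_nonneg (hf p hp)]; exact hK p hp⟩

theorem of_sq (hf : BddOn s fun p => f p ^ 2) : BddOn s f :=
  ((const 1).add hf).mono_abs fun p _ => by
    rw [abs_of_nonneg (by positivity : 0 ≤ 1 + f p ^ 2)]
    nlinarith [sq_nonneg (|f p| - 1), sq_abs (f p), sq_nonneg (f p)]

end BddOn

theorem sub_le_sub_of_hasDerivAt_le {f g f' g' : ℝ → ℝ} {a c x : ℝ} (hx : x ∈ Ico a c)
    (hf : ∀ t ∈ Ico a c, HasDerivAt f (f' t) t) (hg : ∀ t ∈ Ico a c, HasDerivAt g (g' t) t)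
    (h : ∀ t ∈ Ico a c, f' t ≤ g' t) : f x - f a ≤ g x - g a := by
  have hmono : MonotoneOn (fun t => g t - f t) (Ico a c) := by
    refine monotoneOn_of_hasDerivWithinAt_nonneg (f' := fun t => g' t - f' t) (convex_Ico a c)
      (fun t ht => ((hg t ht).sub (hf t ht)).continuousAt.continuousWithinAt)
      (fun t ht => ?_) (fun t ht => ?_)
    · have ht' := interior_subset ht
      exact ((hg t ht').sub (hf t ht')).hasDerivWithinAt
    · exact sub_nonneg.2 (h t (interior_subset ht))
  have := hmono ⟨le_rfl, hx.1.trans_lt hx.2⟩ hx hx.1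
  simp only at this
  linarith

/-- The half-open rectangle `[a, c) × [b, d)`. -/
def rect (a c b d : ℝ) : Set (ℝ × ℝ) := Ico a c ×ˢ Ico b d

/-- The two initial edges of `rect a c b d`. -/
def initialEdges (a c b d : ℝ) : Set (ℝ × ℝ) := {p ∈ rect a c b d | p.1 = a ∨ p.2 = b}

section Integration

variable {a c b d : ℝ} {f g f' g' : ℝ × ℝ → ℝ}

theorem left_mem_initialEdges {p : ℝ × ℝ} (hp : p ∈ rect a c b d) :
    (a, p.2) ∈ initialEdges a c b d :=
  ⟨⟨⟨le_rfl, hp.1.1.trans_lt hp.1.2⟩, hp.2⟩, Or.inl rfl⟩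

theorem bot_mem_initialEdges {p : ℝ × ℝ} (hp : p ∈ rect a c b d) :
    (p.1, b) ∈ initialEdges a c b d :=
  ⟨⟨hp.1, ⟨le_rfl, hp.2.1.trans_lt hp.2.2⟩⟩, Or.inr rfl⟩

theorem exists_le_of_hasDerivAt_fst
    (hf : ∀ p ∈ rect a c b d, HasDerivAt (fun x => f (x, p.2)) (f' p) p.1)
    (hg : ∀ p ∈ rect a c b d, HasDerivAt (fun x => g (x, p.2)) (g' p) p.1)
    (h : ∀ p ∈ rect a c b d, f' p ≤ g' p) (hgb : BddOn (rect a c b d) g)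
    (hfb : ∃ K, ∀ p ∈ initialEdges a c b d, f p ≤ K) : ∃ K, ∀ p ∈ rect a c b d, f p ≤ K := by
  obtain ⟨K, hK⟩ := hfb
  obtain ⟨L, hL⟩ := hgb
  refine ⟨K + 2 * L, fun p hp => ?_⟩
  have hmem : ∀ t ∈ Ico a c, (t, p.2) ∈ rect a c b d := fun t ht => ⟨ht, hp.2⟩
  have hle := sub_le_sub_of_hasDerivAt_le hp.1 (f := fun x => f (x, p.2))
    (g := fun x => g (x, p.2)) (fun t ht => hf _ (hmem t ht)) (fun t ht => hg _ (hmem t ht))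
    (fun t ht => h _ (hmem t ht))
  have h₁ := hK _ (left_mem_initialEdges hp)
  have h₂ := abs_le.1 (hL _ hp)
  have h₃ := abs_le.1 (hL _ (left_mem_initialEdges hp).1)
  simp only [Prod.mk.eta] at hle
  linarith

theorem exists_le_of_hasDerivAt_snd
    (hf : ∀ p ∈ rect a c b d, HasDerivAt (fun y => f (p.1, y)) (f' p) p.2)
    (hg : ∀ p ∈ rect a c b d, HasDerivAt (fun y => g (p.1, y)) (g' p) p.2)
    (h : ∀ p ∈ rect a c b d, f' p ≤ g' p) (hgb : BddOn (rect a c b d) g)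
    (hfb : ∃ K, ∀ p ∈ initialEdges a c b d, f p ≤ K) : ∃ K, ∀ p ∈ rect a c b d, f p ≤ K := by
  obtain ⟨K, hK⟩ := hfb
  obtain ⟨L, hL⟩ := hgb
  refine ⟨K + 2 * L, fun p hp => ?_⟩
  have hmem : ∀ t ∈ Ico b d, (p.1, t) ∈ rect a c b d := fun t ht => ⟨hp.1, ht⟩
  have hle := sub_le_sub_of_hasDerivAt_le hp.2 (f := fun y => f (p.1, y))
    (g := fun y => g (p.1, y)) (fun t ht => hf _ (hmem t ht)) (fun t ht => hg _ (hmem t ht))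
    (fun t ht => h _ (hmem t ht))
  have h₁ := hK _ (bot_mem_initialEdges hp)
  have h₂ := abs_le.1 (hL _ hp)
  have h₃ := abs_le.1 (hL _ (bot_mem_initialEdges hp).1)
  simp only [Prod.mk.eta] at hle
  linarith

theorem bddOn_of_hasDerivAt_fst
    (hf : ∀ p ∈ rect a c b d, HasDerivAt (fun x => f (x, p.2)) (f' p) p.1)
    (hg : ∀ p ∈ rect a c b d, HasDerivAt (fun x => g (x, p.2)) (g' p) p.1)
    (h : ∀ p ∈ rect a c b d, |f' p| ≤ g' p) (hgb : BddOn (rect a c b d) g)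
    (hfb : BddOn (initialEdges a c b d) f) : BddOn (rect a c b d) f :=
  .of_le_of_le
    (exists_le_of_hasDerivAt_fst hf hg (fun p hp => (abs_le'.1 (h p hp)).1) hgb hfb.exists_le)
    (exists_le_of_hasDerivAt_fst (fun p hp => (hf p hp).fun_neg) hg
      (fun p hp => (abs_le'.1 (h p hp)).2) hgb hfb.neg.exists_le)

theorem bddOn_of_hasDerivAt_snd
    (hf : ∀ p ∈ rect a c b d, HasDerivAt (fun y => f (p.1, y)) (f' p) p.2)
    (hg : ∀ p ∈ rect a c b d, HasDerivAt (fun y => g (p.1, y)) (g' p) p.2)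
    (h : ∀ p ∈ rect a c b d, |f' p| ≤ g' p) (hgb : BddOn (rect a c b d) g)
    (hfb : BddOn (initialEdges a c b d) f) : BddOn (rect a c b d) f :=
  .of_le_of_le
    (exists_le_of_hasDerivAt_snd hf hg (fun p hp => (abs_le'.1 (h p hp)).1) hgb hfb.exists_le)
    (exists_le_of_hasDerivAt_snd (fun p hp => (hf p hp).fun_neg) hg
      (fun p hp => (abs_le'.1 (h p hp)).2) hgb hfb.neg.exists_le)

theorem bddOn_rect_fst : BddOn (rect a c b d) Prod.fst :=
  ⟨max (-a) c, fun _ hp => abs_le'.2 ⟨hp.1.2.le.trans (le_max_right _ _),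
    (neg_le_neg hp.1.1).trans (le_max_left _ _)⟩⟩

theorem bddOn_rect_snd : BddOn (rect a c b d) Prod.snd :=
  ⟨max (-b) d, fun _ hp => abs_le'.2 ⟨hp.2.2.le.trans (le_max_right _ _),
    (neg_le_neg hp.2.1).trans (le_max_left _ _)⟩⟩

theorem bddOn_of_bddOn_deriv_fst
    (hf : ∀ p ∈ rect a c b d, HasDerivAt (fun x => f (x, p.2)) (f' p) p.1)
    (hf' : BddOn (rect a c b d) f') (hfb : BddOn (initialEdges a c b d) f) :
    BddOn (rect a c b d) f := by
  obtain ⟨K, hK⟩ := hf'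
  refine bddOn_of_hasDerivAt_fst (g := fun p => p.1 * K) (g' := fun _ => K) hf (fun p _ => ?_)
    hK (bddOn_rect_fst.mul (.const K)) hfb
  simpa using (hasDerivAt_id p.1).mul_const K

theorem bddOn_of_bddOn_deriv_snd
    (hf : ∀ p ∈ rect a c b d, HasDerivAt (fun y => f (p.1, y)) (f' p) p.2)
    (hf' : BddOn (rect a c b d) f') (hfb : BddOn (initialEdges a c b d) f) :
    BddOn (rect a c b d) f := by
  obtain ⟨K, hK⟩ := hf'
  refine bddOn_of_hasDerivAt_snd (g := fun p => p.2 * K) (g' := fun _ => K) hf (fun p _ => ?_)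
    hK (bddOn_rect_snd.mul (.const K)) hfb
  simpa using (hasDerivAt_id p.2).mul_const K

end Integration

/-- A solution of the Einstein–scalar field system on `rect a c b d`, with `w = Ω²`, `n = ∂_u r`,
`l = ∂_v r`, `p = ∂_u φ`, `q = ∂_v φ`, `x = ∂_u log Ω²`, `y = ∂_v log Ω²`, regular and bounded on
the initial edges. -/
structure IsRegularSolution (V : ℝ → ℝ) (a c b d : ℝ) (r n l w φ p q x y : ℝ × ℝ → ℝ) : Prop where
  r_pos : ∀ z ∈ rect a c b d, 0 < r z
  w_pos : ∀ z ∈ rect a c b d, 0 < w z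
  n_neg : ∀ z ∈ rect a c b d, n z < 0
  l_nonneg : ∀ z ∈ rect a c b d, 0 ≤ l z
  r_fst : ∀ z ∈ rect a c b d, HasDerivAt (fun s => r (s, z.2)) (n z) z.1
  r_snd : ∀ z ∈ rect a c b d, HasDerivAt (fun s => r (z.1, s)) (l z) z.2
  φ_snd : ∀ z ∈ rect a c b d, HasDerivAt (fun s => φ (z.1, s)) (q z) z.2
  l_fst : ∀ z ∈ rect a c b d, HasDerivAt (fun s => l (s, z.2))
    (-(1 / r z) * n z * l z - w z / (4 * r z) + r z / 2 * w z * V (φ z)) z.1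
  n_snd : ∀ z ∈ rect a c b d, HasDerivAt (fun s => n (z.1, s))
    (-(1 / r z) * n z * l z - w z / (4 * r z) + r z / 2 * w z * V (φ z)) z.2
  y_fst : ∀ z ∈ rect a c b d, HasDerivAt (fun s => y (s, z.2))
    (w z / (4 * r z ^ 2) + n z * l z / r z ^ 2 - p z * q z) z.1
  x_snd : ∀ z ∈ rect a c b d, HasDerivAt (fun s => x (z.1, s))
    (w z / (4 * r z ^ 2) + n z * l z / r z ^ 2 - p z * q z) z.2
  q_fst : ∀ z ∈ rect a c b d, HasDerivAt (fun s => q (s, z.2))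
    (-(p z * l z) / r z - (q z * n z) / r z - w z / 4 * deriv V (φ z)) z.1
  p_snd : ∀ z ∈ rect a c b d, HasDerivAt (fun s => p (z.1, s))
    (-(p z * l z) / r z - (q z * n z) / r z - w z / 4 * deriv V (φ z)) z.2
  nw_fst : ∀ z ∈ rect a c b d, HasDerivAt (fun s => n (s, z.2) / w (s, z.2))
    (-(r z) * p z ^ 2 / w z) z.1
  lw_snd : ∀ z ∈ rect a c b d, HasDerivAt (fun s => l (z.1, s) / w (z.1, s))
    (-(r z) * q z ^ 2 / w z) z.2
  edge_r : BddOn (initialEdges a c b d) r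
  edge_r_inv : BddOn (initialEdges a c b d) fun z => (r z)⁻¹
  edge_n : BddOn (initialEdges a c b d) n
  edge_n_inv : BddOn (initialEdges a c b d) fun z => (n z)⁻¹
  edge_l : BddOn (initialEdges a c b d) l
  edge_w : BddOn (initialEdges a c b d) w
  edge_w_inv : BddOn (initialEdges a c b d) fun z => (w z)⁻¹
  edge_φ : BddOn (initialEdges a c b d) φ
  edge_p : BddOn (initialEdges a c b d) p
  edge_q : BddOn (initialEdges a c b d) q
  edge_x : BddOn (initialEdges a c b d) x
  edge_y : BddOn (initialEdges a c b d) y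

theorem BddOn.log {s : Set (ℝ × ℝ)} {f : ℝ × ℝ → ℝ} (hpos : ∀ z ∈ s, 0 < f z) (hf : BddOn s f)
    (hf' : BddOn s fun z => (f z)⁻¹) : BddOn s fun z => Real.log (f z) := by
  refine (hf.add hf').mono_abs fun z hz => ?_
  have h := hpos z hz
  have hi := inv_pos.2 h
  have h₁ := Real.log_le_sub_one_of_pos h
  have h₂ := Real.log_le_sub_one_of_pos hi
  rw [Real.log_inv] at h₂
  rw [abs_of_pos (by positivity : 0 < f z + (f z)⁻¹)]
  exact abs_le.2 ⟨by linarith, by linarith⟩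

namespace IsRegularSolution

variable {V : ℝ → ℝ} {a c b d C : ℝ} {r n l w φ p q x y : ℝ × ℝ → ℝ}

theorem bddOn_r (h : IsRegularSolution V a c b d r n l w φ p q x y) : BddOn (rect a c b d) r :=
  .of_nonneg_of_le (fun z hz => (h.r_pos z hz).le) <|
    exists_le_of_hasDerivAt_fst (g := fun _ => 0) (g' := fun _ => 0) h.r_fst
      (fun _ _ => hasDerivAt_const _ _) (fun z hz => (h.n_neg z hz).le) (.const 0)
      h.edge_r.exists_le

theorem bddOn_r_inv (h : IsRegularSolution V a c b d r n l w φ p q x y) :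
    BddOn (rect a c b d) fun z => (r z)⁻¹ :=
  .of_nonneg_of_le (fun z hz => (inv_pos.2 (h.r_pos z hz)).le) <|
    exists_le_of_hasDerivAt_snd (g := fun _ => 0) (g' := fun _ => 0)
      (fun z hz => (h.r_snd z hz).fun_inv (h.r_pos z hz).ne')
      (fun _ _ => hasDerivAt_const _ _)
      (fun z hz => div_nonpos_of_nonpos_of_nonneg (neg_nonpos.2 (h.l_nonneg z hz)) (sq_nonneg _))
      (.const 0) h.edge_r_inv.exists_le

/-- `-Ω² / ∂_u r` is bounded, since it is nonincreasing in `u` by the Raychaudhuri equation. -/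
theorem bddOn_neg_w_div_n (h : IsRegularSolution V a c b d r n l w φ p q x y) :
    BddOn (rect a c b d) fun z => -(w z / n z) := by
  refine .of_nonneg_of_le (fun z hz => ?_) <|
    exists_le_of_hasDerivAt_fst (g := fun _ => 0) (g' := fun _ => 0)
      (f' := fun z => -(r z * p z ^ 2 * w z / n z ^ 2)) (fun z hz => ?_)
      (fun _ _ => hasDerivAt_const _ _) (fun z hz => ?_) (.const 0) ?_
  · exact neg_nonneg.2 (div_nonpos_of_nonneg_of_nonpos (h.w_pos z hz).le (h.n_neg z hz).le)
  · have hw := (h.w_pos z hz).ne'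
    have hn := (h.n_neg z hz).ne
    have := ((h.nw_fst z hz).fun_inv (div_ne_zero hn hw)).fun_neg
    simp only [inv_div] at this
    refine this.congr_deriv ?_
    simp only [Prod.mk.eta]
    field_simp
  · have hw := h.w_pos z hz
    have hr := h.r_pos z hz
    exact neg_nonpos.2 (by positivity)
  · exact (h.edge_w.mul h.edge_n_inv).neg.exists_le

/-- The Hawking mass plus `C r³ / 3`. -/
noncomputable def modMass (C : ℝ) (r n l w : ℝ × ℝ → ℝ) (z : ℝ × ℝ) : ℝ :=
  r z / 2 + 2 * r z * (n z * l z) / w z + C * r z ^ 3 / 3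

theorem modMass_snd (h : IsRegularSolution V a c b d r n l w φ p q x y) (C : ℝ) {z : ℝ × ℝ}
    (hz : z ∈ rect a c b d) :
    HasDerivAt (fun s => modMass C r n l w (z.1, s))
      (r z ^ 2 * l z * (V (φ z) + C) + 2 * r z ^ 2 * (-n z) * q z ^ 2 / w z) z.2 := by
  have hw := (h.w_pos z hz).ne'
  have hr := (h.r_pos z hz).ne'
  have hr' := h.r_snd z hz
  have key := ((hr'.mul_const 2⁻¹).fun_add
    (((hr'.const_mul 2).fun_mul (h.n_snd z hz)).fun_mul (h.lw_snd z hz))).fun_add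
    (((hr'.fun_pow 3).const_mul C).mul_const 3⁻¹)
  refine (key.congr_deriv ?_).congr_of_eventuallyEq (.of_forall fun s => ?_)
  · simp only [Prod.mk.eta]
    field_simp
    push_cast
    ring
  · simp only [modMass]
    ring

theorem modMass_fst (h : IsRegularSolution V a c b d r n l w φ p q x y) (C : ℝ) {z : ℝ × ℝ}
    (hz : z ∈ rect a c b d) :
    HasDerivAt (fun s => modMass C r n l w (s, z.2))
      (-(r z ^ 2 * (-n z) * (V (φ z) + C) + 2 * r z ^ 2 * l z * p z ^ 2 / w z)) z.1 := by
  have hw := (h.w_pos z hz).ne'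
  have hr := (h.r_pos z hz).ne'
  have hr' := h.r_fst z hz
  have key := ((hr'.mul_const 2⁻¹).fun_add
    (((hr'.const_mul 2).fun_mul (h.l_fst z hz)).fun_mul (h.nw_fst z hz))).fun_add
    (((hr'.fun_pow 3).const_mul C).mul_const 3⁻¹)
  refine (key.congr_deriv ?_).congr_of_eventuallyEq (.of_forall fun s => ?_)
  · simp only [Prod.mk.eta]
    field_simp
    push_cast
    ring
  · simp only [modMass]
    ring

theorem bddOn_modMass (h : IsRegularSolution V a c b d r n l w φ p q x y)
    (hV : ∀ s, -C ≤ V s) : BddOn (rect a c b d) (modMass C r n l w) := by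
  refine .of_le_of_le ?_ ?_
  · obtain ⟨K, hK⟩ := ((h.bddOn_r.mul (.const 2⁻¹)).add
      (((h.bddOn_r.pow 3).mul (.const C)).mul (.const 3⁻¹))).exists_le
    refine ⟨K, fun z hz => le_trans ?_ (hK z hz)⟩
    have hw := h.w_pos z hz
    have hr := h.r_pos z hz
    have hnl := mul_nonneg (neg_nonneg.2 (h.n_neg z hz).le) (h.l_nonneg z hz)
    have : 0 ≤ 2 * r z * (-n z * l z) / w z := by positivity
    rw [show 2 * r z * (-n z * l z) / w z = -(2 * r z * (n z * l z) / w z) by ring] at this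
    simp only [modMass]
    linarith
  · refine exists_le_of_hasDerivAt_snd (g := fun _ => 0) (g' := fun _ => 0)
      (fun z hz => (h.modMass_snd C hz).fun_neg) (fun _ _ => hasDerivAt_const _ _)
      (fun z hz => ?_) (.const 0) (BddOn.exists_le ?_)
    · have hw := h.w_pos z hz
      have hr := h.r_pos z hz
      have hl := h.l_nonneg z hz
      have hn := neg_pos.2 (h.n_neg z hz)
      have hv : 0 ≤ V (φ z) + C := by linarith [hV (φ z)]
      exact neg_nonpos.2 (by positivity)
    · refine BddOn.neg ?_
      refine (((h.edge_r.mul (.const 2⁻¹)).add (((h.edge_r.mul (.const 2)).mul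
        (h.edge_n.mul h.edge_l)).mul h.edge_w_inv)).add
        (((h.edge_r.pow 3).mul (.const C)).mul (.const 3⁻¹))).congr fun z _ => ?_
      simp only [modMass, div_eq_mul_inv]
      ring

theorem log_neg_n_snd (h : IsRegularSolution V a c b d r n l w φ p q x y) {z : ℝ × ℝ}
    (hz : z ∈ rect a c b d) :
    HasDerivAt (fun s => Real.log (-n (z.1, s)))
      (-(l z * (r z)⁻¹) + -(w z / n z) * (r z)⁻¹ * 4⁻¹ - -(w z / n z) * r z * V (φ z) * 2⁻¹)
      z.2 := by
  have hn := h.n_neg z hz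
  have hr := (h.r_pos z hz).ne'
  refine (((h.n_snd z hz).fun_neg).log (neg_pos.2 hn).ne').congr_deriv ?_
  simp only [Prod.mk.eta]
  have hn' := hn.ne
  field_simp
  ring

theorem edge_log_neg_n (h : IsRegularSolution V a c b d r n l w φ p q x y) :
    BddOn (initialEdges a c b d) fun z => Real.log (-n z) :=
  .log (fun z hz => neg_pos.2 (h.n_neg z hz.1)) h.edge_n.neg
    (h.edge_n_inv.neg.congr fun _ _ => inv_neg)

theorem bddOn_n (h : IsRegularSolution V a c b d r n l w φ p q x y)
    (hV : ∀ s, -C ≤ V s) : BddOn (rect a c b d) n := by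
  have hκ := h.bddOn_neg_w_div_n
  obtain ⟨K, hK⟩ := (((hκ.mul h.bddOn_r_inv).mul (.const 4⁻¹)).add
    (((hκ.mul h.bddOn_r).mul (.const C)).mul (.const 2⁻¹))).exists_le
  have hle : ∀ z ∈ rect a c b d, -(l z * (r z)⁻¹) + -(w z / n z) * (r z)⁻¹ * 4⁻¹
      - -(w z / n z) * r z * V (φ z) * 2⁻¹ ≤ K := fun z hz => by
    have hr := h.r_pos z hz
    have hκ' : 0 < -(w z / n z) := neg_pos.2 (div_neg_of_pos_of_neg (h.w_pos z hz) (h.n_neg z hz))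
    have h₁ : 0 ≤ l z * (r z)⁻¹ := mul_nonneg (h.l_nonneg z hz) (inv_pos.2 hr).le
    have h₂ : 0 ≤ -(w z / n z) * r z * (V (φ z) + C) :=
      mul_nonneg (by positivity) (by linarith [hV (φ z)])
    have := hK z hz
    linarith
  obtain ⟨L, hL⟩ := exists_le_of_hasDerivAt_snd (g := fun z => z.2 * K) (g' := fun _ => K)
    (fun z hz => h.log_neg_n_snd hz)
    (fun z _ => by simpa using (hasDerivAt_id z.2).mul_const K) hle
    (bddOn_rect_snd.mul (.const K)) h.edge_log_neg_n.exists_le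
  refine ⟨Real.exp L, fun z hz => ?_⟩
  rw [abs_of_neg (h.n_neg z hz)]
  exact (Real.log_le_iff_le_exp (neg_pos.2 (h.n_neg z hz))).1 (hL z hz)

theorem bddOn_w (h : IsRegularSolution V a c b d r n l w φ p q x y)
    (hV : ∀ s, -C ≤ V s) : BddOn (rect a c b d) w :=
  (h.bddOn_neg_w_div_n.mul (h.bddOn_n hV).neg).congr fun z hz => by
    have hn := (h.n_neg z hz).ne
    field_simp

theorem bddOn_l (h : IsRegularSolution V a c b d r n l w φ p q x y)
    (hV : ∀ s, -C ≤ V s) : BddOn (rect a c b d) l := by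
  have hw := h.bddOn_w hV
  have hM := h.bddOn_modMass hV
  obtain ⟨K, hK⟩ := (((hw.mul (h.bddOn_r_inv.pow 2)).mul (.const (-2⁻¹))).mul (hM.sub
    (((h.bddOn_r.pow 3).mul (.const C)).mul (.const 3⁻¹)))).sub
    (((h.bddOn_r.mul hw).mul (.const C)).mul (.const 2⁻¹)) |>.exists_le
  obtain ⟨L, hL0, hL⟩ := ((h.bddOn_neg_w_div_n.mul h.bddOn_r_inv).mul (.const 2⁻¹)).exists_pos
  refine .of_nonneg_of_le h.l_nonneg <|
    exists_le_of_hasDerivAt_fst (g := fun z => z.1 * K - L * modMass C r n l w z)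
    h.l_fst (fun z hz => ((hasDerivAt_id z.1).mul_const K).fun_sub
      ((h.modMass_fst C hz).const_mul L)) (fun z hz => ?_)
    ((bddOn_rect_fst.mul (.const K)).sub ((BddOn.const L).mul hM)) h.edge_l.exists_le
  have hr := h.r_pos z hz
  have hwp := h.w_pos z hz
  have hn := neg_pos.2 (h.n_neg z hz)
  have hl := h.l_nonneg z hz
  have hv : 0 ≤ V (φ z) + C := by linarith [hV (φ z)]
  have h₁ := hK z hz
  have h₂ := mul_le_mul_of_nonneg_right ((le_abs_self _).trans (hL z hz))
    (by positivity : 0 ≤ r z ^ 2 * (-n z) * (V (φ z) + C))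
  have h₃ : 0 ≤ L * (2 * r z ^ 2 * l z * p z ^ 2 / w z) := by positivity
  have h₄ : -(1 / r z) * n z * l z - w z / (4 * r z) + r z / 2 * w z * V (φ z)
      = (w z * (r z)⁻¹ ^ 2 * (-2⁻¹) * (modMass C r n l w z - r z ^ 3 * C * 3⁻¹)
        - r z * w z * C * 2⁻¹)
        + -(w z / n z) * (r z)⁻¹ * 2⁻¹ * (r z ^ 2 * (-n z) * (V (φ z) + C)) := by
    have hn' := (h.n_neg z hz).ne
    simp only [modMass]
    field_simp
    ring
  rw [h₄]
  linarith

/-- `(∂_v φ)²` is controlled by the `v`-derivative of the modified mass. -/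
theorem exists_sq_q_le (h : IsRegularSolution V a c b d r n l w φ p q x y)
    (hV : ∀ s, -C ≤ V s) : ∃ K, 0 ≤ K ∧ ∀ z ∈ rect a c b d, q z ^ 2 ≤
      K * (r z ^ 2 * l z * (V (φ z) + C) + 2 * r z ^ 2 * (-n z) * q z ^ 2 / w z) := by
  obtain ⟨K, hK0, hK⟩ :=
    ((h.bddOn_neg_w_div_n.mul (h.bddOn_r_inv.pow 2)).mul (.const 2⁻¹)).exists_pos
  refine ⟨K, hK0.le, fun z hz => ?_⟩
  have hr := h.r_pos z hz
  have hw := h.w_pos z hz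
  have hn := neg_pos.2 (h.n_neg z hz)
  have hl := h.l_nonneg z hz
  have hv : 0 ≤ V (φ z) + C := by linarith [hV (φ z)]
  have h₁ : 0 ≤ K * (r z ^ 2 * l z * (V (φ z) + C)) := by positivity
  have h₂ := mul_le_mul_of_nonneg_right ((le_abs_self _).trans (hK z hz))
    (by positivity : 0 ≤ 2 * r z ^ 2 * (-n z) * q z ^ 2 / w z)
  have h₃ : -(w z / n z) * (r z)⁻¹ ^ 2 * 2⁻¹ * (2 * r z ^ 2 * (-n z) * q z ^ 2 / w z)
      = q z ^ 2 := by
    have hn' := (h.n_neg z hz).ne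
    field_simp
  rw [h₃] at h₂
  linarith

/-- Functions whose `v`-derivative grows at most linearly in `∂_v φ` are bounded. -/
theorem bddOn_of_abs_deriv_le (h : IsRegularSolution V a c b d r n l w φ p q x y)
    (hV : ∀ s, -C ≤ V s) {f f' : ℝ × ℝ → ℝ} {K : ℝ} (hK : 0 ≤ K)
    (hf : ∀ z ∈ rect a c b d, HasDerivAt (fun s => f (z.1, s)) (f' z) z.2)
    (hf' : ∀ z ∈ rect a c b d, |f' z| ≤ K * (1 + |q z|))
    (hfb : BddOn (initialEdges a c b d) f) : BddOn (rect a c b d) f := by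
  obtain ⟨L, hL0, hL⟩ := h.exists_sq_q_le hV
  refine bddOn_of_hasDerivAt_snd
    (g := fun z => K * (z.2 * 2 + L * modMass C r n l w z)) hf
    (fun z hz => ((((hasDerivAt_id z.2).mul_const 2).fun_add
      ((h.modMass_snd C hz).const_mul L)).const_mul K)) (fun z hz => ?_)
    ((BddOn.const K).mul ((bddOn_rect_snd.mul (.const 2)).add
      ((BddOn.const L).mul (h.bddOn_modMass hV)))) hfb
  refine (hf' z hz).trans (mul_le_mul_of_nonneg_left ?_ hK)
  have h₁ := hL z hz
  have h₂ := sq_abs (q z)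
  nlinarith [sq_nonneg (|q z| - 1), sq_nonneg (q z)]

theorem bddOn_φ (h : IsRegularSolution V a c b d r n l w φ p q x y)
    (hV : ∀ s, -C ≤ V s) : BddOn (rect a c b d) φ :=
  h.bddOn_of_abs_deriv_le hV zero_le_one h.φ_snd (fun z _ => by simp) h.edge_φ

theorem bddOn_n_inv (h : IsRegularSolution V a c b d r n l w φ p q x y)
    (hV : ∀ s, -C ≤ V s) (hVc : Continuous V) :
    BddOn (rect a c b d) fun z => (n z)⁻¹ := by
  have hκ := h.bddOn_neg_w_div_n
  have hr := h.bddOn_r_inv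
  have hlog := bddOn_of_bddOn_deriv_snd (fun z hz => h.log_neg_n_snd hz)
    ((((h.bddOn_l hV).mul hr).neg.add ((hκ.mul hr).mul (.const 4⁻¹))).sub
      (((hκ.mul h.bddOn_r).mul ((h.bddOn_φ hV).comp_continuous hVc)).mul (.const 2⁻¹)))
    h.edge_log_neg_n
  refine (hlog.neg.comp_continuous Real.continuous_exp).neg.congr fun z hz => ?_
  rw [Real.exp_neg, Real.exp_log (neg_pos.2 (h.n_neg z hz)), inv_neg, neg_neg]

theorem bddOn_p (h : IsRegularSolution V a c b d r n l w φ p q x y)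
    (hV : ∀ s, -C ≤ V s) (hVd : Continuous (deriv V)) :
    BddOn (rect a c b d) p := by
  obtain ⟨K, hK0, hK⟩ := (h.bddOn_n hV).exists_pos
  obtain ⟨L, hL0, hL⟩ := ((h.bddOn_r.mul (h.bddOn_w hV)).mul
    (((h.bddOn_φ hV).comp_continuous hVd).mul (.const 4⁻¹))).exists_pos
  have hζ : BddOn (rect a c b d) fun z => r z * p z := by
    refine h.bddOn_of_abs_deriv_le hV (K := K + L) (by positivity)
      (f' := fun z => -(q z * n z) - r z * w z * (deriv V (φ z) * 4⁻¹))
      (fun z hz => ((h.r_snd z hz).fun_mul (h.p_snd z hz)).congr_deriv ?_) (fun z hz => ?_)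
      (h.edge_r.mul h.edge_p)
    · have hr := (h.r_pos z hz).ne'
      simp only [Prod.mk.eta]
      field_simp
      ring
    · have h₁ := abs_sub (-(q z * n z)) (r z * w z * (deriv V (φ z) * 4⁻¹))
      rw [abs_neg, abs_mul (q z)] at h₁
      have h₂ := mul_le_mul_of_nonneg_left (hK z hz) (abs_nonneg (q z))
      have h₃ := mul_nonneg hL0.le (abs_nonneg (q z))
      have h₄ := hL z hz
      linarith
  refine (hζ.mul h.bddOn_r_inv).congr fun z hz => ?_
  have hr := (h.r_pos z hz).ne'
  field_simp

theorem bddOn_q (h : IsRegularSolution V a c b d r n l w φ p q x y)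
    (hV : ∀ s, -C ≤ V s) (hVd : Continuous (deriv V)) :
    BddOn (rect a c b d) q := by
  have hθ : BddOn (rect a c b d) fun z => r z * q z := by
    refine bddOn_of_bddOn_deriv_fst
      (f' := fun z => -(p z * l z) - r z * w z * (deriv V (φ z) * 4⁻¹))
      (fun z hz => ((h.r_fst z hz).fun_mul (h.q_fst z hz)).congr_deriv ?_)
      (((h.bddOn_p hV hVd).mul (h.bddOn_l hV)).neg.sub
        ((h.bddOn_r.mul (h.bddOn_w hV)).mul
          (((h.bddOn_φ hV).comp_continuous hVd).mul (.const 4⁻¹))))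
      (h.edge_r.mul h.edge_q)
    have hr := (h.r_pos z hz).ne'
    simp only [Prod.mk.eta]
    field_simp
    ring
  refine (hθ.mul h.bddOn_r_inv).congr fun z hz => ?_
  have hr := (h.r_pos z hz).ne'
  field_simp

theorem bddOn_w_inv (h : IsRegularSolution V a c b d r n l w φ p q x y)
    (hV : ∀ s, -C ≤ V s) (hVc : Continuous V) (hVd : Continuous (deriv V)) :
    BddOn (rect a c b d) fun z => (w z)⁻¹ := by
  have hpos : ∀ z ∈ rect a c b d, 0 < -(n z / w z) := fun z hz =>
    neg_pos.2 (div_neg_of_neg_of_pos (h.n_neg z hz) (h.w_pos z hz))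
  have hn := h.bddOn_n_inv hV hVc
  have hlog : BddOn (rect a c b d) fun z => Real.log (-(n z / w z)) := by
    refine bddOn_of_bddOn_deriv_fst (f' := fun z => -(r z * p z ^ 2 * (n z)⁻¹))
      (fun z hz => ((h.nw_fst z hz).fun_neg.log (hpos z hz).ne').congr_deriv ?_)
      ((h.bddOn_r.mul ((h.bddOn_p hV hVd).pow 2)).mul hn).neg ?_
    · have hw := (h.w_pos z hz).ne'
      have hn := (h.n_neg z hz).ne
      simp only [Prod.mk.eta]
      field_simp
    · refine .log (fun z hz => hpos z hz.1) (h.edge_n.mul h.edge_w_inv).neg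
        ((h.edge_w.mul h.edge_n_inv).neg.congr fun z hz => ?_)
      rw [inv_neg, inv_div, div_eq_mul_inv]
  refine ((hlog.comp_continuous Real.continuous_exp).mul hn).neg.congr fun z hz => ?_
  have hn := (h.n_neg z hz).ne
  rw [Real.exp_log (hpos z hz)]
  field_simp

theorem bddOn_log_deriv (h : IsRegularSolution V a c b d r n l w φ p q x y)
    (hV : ∀ s, -C ≤ V s) (hVd : Continuous (deriv V)) :
    BddOn (rect a c b d) x ∧ BddOn (rect a c b d) y := by
  have hr := h.bddOn_r_inv.pow 2
  have hb : BddOn (rect a c b d)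
      fun z => w z / (4 * r z ^ 2) + n z * l z / r z ^ 2 - p z * q z := by
    refine (((((h.bddOn_w hV).mul (.const 4⁻¹)).mul hr).add
      (((h.bddOn_n hV).mul (h.bddOn_l hV)).mul hr)).sub
      ((h.bddOn_p hV hVd).mul (h.bddOn_q hV hVd))).congr fun z hz => ?_
    have hr := (h.r_pos z hz).ne'
    field_simp
  exact ⟨bddOn_of_bddOn_deriv_snd h.x_snd hb h.edge_x,
    bddOn_of_bddOn_deriv_fst h.y_fst hb h.edge_y⟩

end IsRegularSolution

/-- The closed rectangle with its upper right corner removed. -/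
def cornerlessRect (u₀ u₁ v₀ v₁ : ℝ) : Set (ℝ × ℝ) := Icc u₀ u₁ ×ˢ Icc v₀ v₁ \ {(u₁, v₁)}

/-- First partial derivative within `s`. -/
noncomputable def fstDerivWithin (s : Set (ℝ × ℝ)) (F : ℝ × ℝ → ℝ) (z : ℝ × ℝ) : ℝ :=
  fderivWithin ℝ F s z (1, 0)

/-- Second partial derivative within `s`. -/
noncomputable def sndDerivWithin (s : Set (ℝ × ℝ)) (F : ℝ × ℝ → ℝ) (z : ℝ × ℝ) : ℝ :=
  fderivWithin ℝ F s z (0, 1)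

theorem uniqueDiffWithinAt_Ioo_of_mem_Icc {a b x : ℝ} (hab : a < b) (hx : x ∈ Icc a b) :
    UniqueDiffWithinAt ℝ (Ioo a b) x := by
  refine uniqueDiffWithinAt_convex (convex_Ioo a b) ?_ ?_
  · rw [interior_Ioo]
    exact nonempty_Ioo.2 hab
  · rwa [closure_Ioo hab.ne]

theorem abs_deriv_le_of_eqOn_Ioo {f g : ℝ → ℝ} {a b x g' : ℝ} (hab : a < b) (hx : x ∈ Icc a b)
    (hg : HasDerivWithinAt g g' (Ioo a b) x) (hfg : EqOn f g (Ioo a b)) :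
    |deriv f x| ≤ |g'| := by
  by_cases hf : DifferentiableAt ℝ f x
  · have hu := uniqueDiffWithinAt_Ioo_of_mem_Icc hab hx
    have hne : (nhdsWithin x (Ioo a b)).NeBot := by
      rw [← mem_closure_iff_nhdsWithin_neBot, closure_Ioo hab.ne]
      exact hx
    have hfg' : f =ᶠ[nhdsWithin x (Ioo a b)] g := Filter.eventually_of_mem self_mem_nhdsWithin hfg
    have hx' : f x = g x := tendsto_nhds_unique
      (hf.continuousAt.continuousWithinAt.tendsto.congr' hfg') hg.continuousWithinAt.tendsto
    exact (congrArg _ (hu.eq_deriv _ (hf.hasDerivAt.hasDerivWithinAt)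
      (hg.congr hfg hx'))).le
  · rw [deriv_zero_of_not_differentiableAt hf, abs_zero]
    exact abs_nonneg _

section CornerlessRect

variable {u₀ u₁ v₀ v₁ : ℝ}

theorem convex_cornerlessRect : Convex ℝ (cornerlessRect u₀ u₁ v₀ v₁) := by
  intro x hx y hy s t hs ht hst
  have hc := (convex_Icc (𝕜 := ℝ) u₀ u₁).prod (convex_Icc (𝕜 := ℝ) v₀ v₁)
  refine ⟨hc hx.1 hy.1 hs ht hst, fun heq => ?_⟩
  obtain ⟨⟨hx₁, hx₂⟩, hxne⟩ := hx
  obtain ⟨⟨hy₁, hy₂⟩, hyne⟩ := hy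
  have h₁ : s * x.1 + t * y.1 = u₁ := congrArg Prod.fst heq
  have h₂ : s * x.2 + t * y.2 = v₁ := congrArg Prod.snd heq
  have hs₁ : s * (u₁ - x.1) + t * (u₁ - y.1) = 0 := by linear_combination u₁ * hst - h₁
  have hs₂ : s * (v₁ - x.2) + t * (v₁ - y.2) = 0 := by linear_combination v₁ * hst - h₂
  have e₁ := mul_nonneg hs (sub_nonneg.2 hx₁.2)
  have e₂ := mul_nonneg ht (sub_nonneg.2 hy₁.2)
  have e₃ := mul_nonneg hs (sub_nonneg.2 hx₂.2)
  have e₄ := mul_nonneg ht (sub_nonneg.2 hy₂.2)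
  rcases hs.eq_or_lt with rfl | hs
  · have ht1 : t = 1 := by linarith
    subst ht1
    exact hyne (Prod.ext (by linarith) (by linarith))
  · have f₁ : s * (u₁ - x.1) = 0 := by linarith
    have f₂ : s * (v₁ - x.2) = 0 := by linarith
    have g₁ := (mul_eq_zero.1 f₁).resolve_left hs.ne'
    have g₂ := (mul_eq_zero.1 f₂).resolve_left hs.ne'
    exact hxne (Prod.ext (by linarith) (by linarith))

theorem mk_mem_cornerlessRect_of_fst {x v : ℝ} (hx : x ∈ Ioo u₀ u₁) (hv : v ∈ Icc v₀ v₁) :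
    (x, v) ∈ cornerlessRect u₀ u₁ v₀ v₁ :=
  ⟨⟨Ioo_subset_Icc_self hx, hv⟩, fun h => hx.2.ne (congrArg Prod.fst h)⟩

theorem mk_mem_cornerlessRect_of_snd {u y : ℝ} (hu : u ∈ Icc u₀ u₁) (hy : y ∈ Ioo v₀ v₁) :
    (u, y) ∈ cornerlessRect u₀ u₁ v₀ v₁ :=
  ⟨⟨hu, Ioo_subset_Icc_self hy⟩, fun h => hy.2.ne (congrArg Prod.snd h)⟩

theorem nonempty_interior_cornerlessRect (hu : u₀ < u₁) (hv : v₀ < v₁) :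
    (interior (cornerlessRect u₀ u₁ v₀ v₁)).Nonempty := by
  have hsub : Ioo u₀ u₁ ×ˢ Ioo v₀ v₁ ⊆ interior (cornerlessRect u₀ u₁ v₀ v₁) :=
    interior_maximal (fun z hz => mk_mem_cornerlessRect_of_fst hz.1 (Ioo_subset_Icc_self hz.2))
      (isOpen_Ioo.prod isOpen_Ioo)
  exact ((nonempty_Ioo.2 hu).prod (nonempty_Ioo.2 hv)).mono hsub

theorem uniqueDiffOn_cornerlessRect (hu : u₀ < u₁) (hv : v₀ < v₁) :
    UniqueDiffOn ℝ (cornerlessRect u₀ u₁ v₀ v₁) :=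
  uniqueDiffOn_convex convex_cornerlessRect (nonempty_interior_cornerlessRect hu hv)

section Slices

variable {F : ℝ × ℝ → ℝ} {z : ℝ × ℝ}

local notation "D" => cornerlessRect u₀ u₁ v₀ v₁

theorem hasDerivWithinAt_fst (hF : DifferentiableOn ℝ F D) (hz : z ∈ D) :
    HasDerivWithinAt (fun x => F (x, z.2)) (fstDerivWithin D F z) (Ioo u₀ u₁) z.1 :=
  HasFDerivWithinAt.comp_hasDerivWithinAt (t := D) (f := fun x => (x, z.2)) z.1
    (hF z hz).hasFDerivWithinAt
    ((hasDerivAt_id z.1).prodMk (hasDerivAt_const z.1 z.2)).hasDerivWithinAt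
    fun _ hx => mk_mem_cornerlessRect_of_fst hx hz.1.2

theorem hasDerivWithinAt_snd (hF : DifferentiableOn ℝ F D) (hz : z ∈ D) :
    HasDerivWithinAt (fun y => F (z.1, y)) (sndDerivWithin D F z) (Ioo v₀ v₁) z.2 :=
  HasFDerivWithinAt.comp_hasDerivWithinAt (t := D) (f := fun y => (z.1, y)) z.2
    (hF z hz).hasFDerivWithinAt
    ((hasDerivAt_const z.2 z.1).prodMk (hasDerivAt_id z.2)).hasDerivWithinAt
    fun _ hy => mk_mem_cornerlessRect_of_snd hz.1.1 hy

theorem hasDerivAt_fst (hF : DifferentiableOn ℝ F D) (hz : z ∈ Ioo u₀ u₁ ×ˢ Icc v₀ v₁) :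
    HasDerivAt (fun x => F (x, z.2)) (fstDerivWithin D F z) z.1 :=
  (hasDerivWithinAt_fst hF (mk_mem_cornerlessRect_of_fst hz.1 hz.2)).hasDerivAt
    (Ioo_mem_nhds hz.1.1 hz.1.2)

theorem hasDerivAt_snd (hF : DifferentiableOn ℝ F D) (hz : z ∈ Icc u₀ u₁ ×ˢ Ioo v₀ v₁) :
    HasDerivAt (fun y => F (z.1, y)) (sndDerivWithin D F z) z.2 :=
  (hasDerivWithinAt_snd hF (mk_mem_cornerlessRect_of_snd hz.1 hz.2)).hasDerivAt
    (Ioo_mem_nhds hz.2.1 hz.2.2)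

theorem contDiffOn_fstDerivWithin (hu : u₀ < u₁) (hv : v₀ < v₁) (hF : ContDiffOn ℝ 2 F D) :
    ContDiffOn ℝ 1 (fstDerivWithin D F) D :=
  (hF.fderivWithin (uniqueDiffOn_cornerlessRect hu hv) (by norm_num)).clm_apply contDiffOn_const

theorem contDiffOn_sndDerivWithin (hu : u₀ < u₁) (hv : v₀ < v₁) (hF : ContDiffOn ℝ 2 F D) :
    ContDiffOn ℝ 1 (sndDerivWithin D F) D :=
  (hF.fderivWithin (uniqueDiffOn_cornerlessRect hu hv) (by norm_num)).clm_apply contDiffOn_const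

theorem continuousOn_fstDerivWithin (hu : u₀ < u₁) (hv : v₀ < v₁) (hF : ContDiffOn ℝ 1 F D) :
    ContinuousOn (fstDerivWithin D F) D :=
  (hF.continuousOn_fderivWithin (uniqueDiffOn_cornerlessRect hu hv) le_rfl).clm_apply
    continuousOn_const

theorem continuousOn_sndDerivWithin (hu : u₀ < u₁) (hv : v₀ < v₁) (hF : ContDiffOn ℝ 1 F D) :
    ContinuousOn (sndDerivWithin D F) D :=
  (hF.continuousOn_fderivWithin (uniqueDiffOn_cornerlessRect hu hv) le_rfl).clm_apply
    continuousOn_const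

theorem fstDerivWithin_sndDerivWithin_comm (hu : u₀ < u₁) (hv : v₀ < v₁)
    (hF : ContDiffOn ℝ 2 F D) (hz : z ∈ D) :
    fstDerivWithin D (sndDerivWithin D F) z = sndDerivWithin D (fstDerivWithin D F) z := by
  have hD := uniqueDiffOn_cornerlessRect hu hv
  have hcl : z ∈ closure (interior D) := by
    rw [convex_cornerlessRect.closure_interior_eq_closure_of_nonempty_interior
      (nonempty_interior_cornerlessRect hu hv)]
    exact subset_closure hz
  have hsymm : IsSymmSndFDerivWithinAt ℝ F D z :=
    (hF z hz).isSymmSndFDerivWithinAt (by simp) hD hcl hz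
  have hd : DifferentiableWithinAt ℝ (fderivWithin ℝ F D) D z :=
    (hF.fderivWithin hD (m := 1) (by norm_num)).differentiableOn (by norm_num) z hz
  have key : ∀ e e' : ℝ × ℝ, fderivWithin ℝ (fun z => fderivWithin ℝ F D z e) D z e'
      = fderivWithin ℝ (fderivWithin ℝ F D) D z e' e := fun e e' => by
    rw [fderivWithin_clm_apply (hD z hz) hd (differentiableWithinAt_const e)]
    simp
  exact (key _ _).trans ((hsymm _ _).trans (key _ _).symm)

variable {f : ℝ → ℝ → ℝ}

theorem pu_eq_fstDerivWithin (hF : DifferentiableOn ℝ (fun z : ℝ × ℝ => f z.1 z.2) D)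
    (hz : z ∈ Ioo u₀ u₁ ×ˢ Icc v₀ v₁) :
    pu f z.1 z.2 = fstDerivWithin D (fun z : ℝ × ℝ => f z.1 z.2) z :=
  (hasDerivAt_fst hF hz).deriv

theorem pv_eq_sndDerivWithin (hF : DifferentiableOn ℝ (fun z : ℝ × ℝ => f z.1 z.2) D)
    (hz : z ∈ Icc u₀ u₁ ×ˢ Ioo v₀ v₁) :
    pv f z.1 z.2 = sndDerivWithin D (fun z : ℝ × ℝ => f z.1 z.2) z :=
  (hasDerivAt_snd hF hz).deriv

theorem pu_eq_fstDerivWithin_of_ne_zero (hu : u₀ < u₁)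
    (hF : DifferentiableOn ℝ (fun z : ℝ × ℝ => f z.1 z.2) D) (hz : z ∈ D)
    (hne : pu f z.1 z.2 ≠ 0) :
    pu f z.1 z.2 = fstDerivWithin D (fun z : ℝ × ℝ => f z.1 z.2) z :=
  (uniqueDiffWithinAt_Ioo_of_mem_Icc hu hz.1.1).eq_deriv _
    (differentiableAt_of_deriv_ne_zero hne).hasDerivAt.hasDerivWithinAt
    (hasDerivWithinAt_fst hF hz)

theorem abs_pu_le (hu : u₀ < u₁) (hF : DifferentiableOn ℝ (fun z : ℝ × ℝ => f z.1 z.2) D)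
    (hz : z ∈ D) : |pu f z.1 z.2| ≤ |fstDerivWithin D (fun z : ℝ × ℝ => f z.1 z.2) z| :=
  abs_deriv_le_of_eqOn_Ioo hu hz.1.1 (hasDerivWithinAt_fst hF hz) fun _ _ => rfl

theorem abs_pv_le (hv : v₀ < v₁) (hF : DifferentiableOn ℝ (fun z : ℝ × ℝ => f z.1 z.2) D)
    (hz : z ∈ D) : |pv f z.1 z.2| ≤ |sndDerivWithin D (fun z : ℝ × ℝ => f z.1 z.2) z| :=
  abs_deriv_le_of_eqOn_Ioo hv hz.1.2 (hasDerivWithinAt_snd hF hz) fun _ _ => rfl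

theorem abs_pu_pu_le (hu : u₀ < u₁) (hv : v₀ < v₁)
    (hF : ContDiffOn ℝ 2 (fun z : ℝ × ℝ => f z.1 z.2) D) (hz : z ∈ D) :
    |pu (pu f) z.1 z.2|
      ≤ |fstDerivWithin D (fstDerivWithin D fun z : ℝ × ℝ => f z.1 z.2) z| :=
  abs_deriv_le_of_eqOn_Ioo hu hz.1.1 (hasDerivWithinAt_fst
    ((contDiffOn_fstDerivWithin hu hv hF).differentiableOn one_ne_zero) hz) fun x hx =>
      pu_eq_fstDerivWithin (z := (x, z.2)) (hF.differentiableOn two_ne_zero) ⟨hx, hz.1.2⟩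

theorem abs_pv_pv_le (hu : u₀ < u₁) (hv : v₀ < v₁)
    (hF : ContDiffOn ℝ 2 (fun z : ℝ × ℝ => f z.1 z.2) D) (hz : z ∈ D) :
    |pv (pv f) z.1 z.2|
      ≤ |sndDerivWithin D (sndDerivWithin D fun z : ℝ × ℝ => f z.1 z.2) z| :=
  abs_deriv_le_of_eqOn_Ioo hv hz.1.2 (hasDerivWithinAt_snd
    ((contDiffOn_sndDerivWithin hu hv hF).differentiableOn one_ne_zero) hz) fun y hy =>
      pv_eq_sndDerivWithin (z := (z.1, y)) (hF.differentiableOn two_ne_zero) ⟨hz.1.1, hy⟩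

theorem pu_pv_eq (hu : u₀ < u₁) (hv : v₀ < v₁)
    (hF : ContDiffOn ℝ 2 (fun z : ℝ × ℝ => f z.1 z.2) D) (hz : z ∈ Ioo u₀ u₁ ×ˢ Ioo v₀ v₁) :
    pu (pv f) z.1 z.2
      = fstDerivWithin D (sndDerivWithin D fun z : ℝ × ℝ => f z.1 z.2) z := by
  have h := hasDerivAt_fst (z := z)
    ((contDiffOn_sndDerivWithin hu hv hF).differentiableOn one_ne_zero)
    ⟨hz.1, Ioo_subset_Icc_self hz.2⟩
  rw [← h.deriv]
  refine Filter.EventuallyEq.deriv_eq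
    (Filter.eventually_of_mem (Ioo_mem_nhds hz.1.1 hz.1.2) fun x hx => ?_)
  exact pv_eq_sndDerivWithin (z := (x, z.2)) (hF.differentiableOn two_ne_zero)
    ⟨Ioo_subset_Icc_self hx, hz.2⟩

theorem hasDerivAt_fst_fst_of_pu_pv (hu : u₀ < u₁) (hv : v₀ < v₁)
    (hF : ContDiffOn ℝ 2 (fun z : ℝ × ℝ => f z.1 z.2) D) (hz : z ∈ Ioo u₀ u₁ ×ˢ Ioo v₀ v₁)
    {X : ℝ} (hX : pu (pv f) z.1 z.2 = X) :
    HasDerivAt (fun x => sndDerivWithin D (fun z : ℝ × ℝ => f z.1 z.2) (x, z.2)) X z.1 := by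
  rw [← hX, pu_pv_eq hu hv hF hz]
  exact hasDerivAt_fst ((contDiffOn_sndDerivWithin hu hv hF).differentiableOn one_ne_zero)
    ⟨hz.1, Ioo_subset_Icc_self hz.2⟩

theorem hasDerivAt_snd_fst_of_pu_pv (hu : u₀ < u₁) (hv : v₀ < v₁)
    (hF : ContDiffOn ℝ 2 (fun z : ℝ × ℝ => f z.1 z.2) D) (hz : z ∈ Ioo u₀ u₁ ×ˢ Ioo v₀ v₁)
    {X : ℝ} (hX : pu (pv f) z.1 z.2 = X) :
    HasDerivAt (fun y => fstDerivWithin D (fun z : ℝ × ℝ => f z.1 z.2) (z.1, y)) X z.2 := by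
  have hzD : z ∈ D := mk_mem_cornerlessRect_of_fst hz.1 (Ioo_subset_Icc_self hz.2)
  rw [← hX, pu_pv_eq hu hv hF hz, fstDerivWithin_sndDerivWithin_comm hu hv hF hzD]
  exact hasDerivAt_snd ((contDiffOn_fstDerivWithin hu hv hF).differentiableOn one_ne_zero)
    ⟨Ioo_subset_Icc_self hz.1, hz.2⟩

end Slices

section Extension

variable {a b : ℝ} {g : ℝ × ℝ → ℝ}

theorem bddOn_strip (hau : a < u₁) (hbv : b < v₁)
    (hg : ContinuousOn g (cornerlessRect u₀ u₁ v₀ v₁)) :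
    BddOn {z ∈ Icc u₀ u₁ ×ˢ Icc v₀ v₁ | z.1 ≤ a ∨ z.2 ≤ b} g := by
  have hcl : IsClosed {z : ℝ × ℝ | z.1 ≤ a ∨ z.2 ≤ b} :=
    (isClosed_le continuous_fst continuous_const).union
      (isClosed_le continuous_snd continuous_const)
  refine ((isCompact_Icc.prod isCompact_Icc).inter_right hcl).exists_bound_of_continuousOn
    (hg.mono fun z hz => ⟨hz.1, fun heq => ?_⟩)
  obtain rfl : z = (u₁, v₁) := heq
  exact hz.2.elim hau.not_ge hbv.not_ge

theorem bddOn_initialEdges (ha : a ∈ Ico u₀ u₁) (hb : b ∈ Ico v₀ v₁)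
    (hg : ContinuousOn g (cornerlessRect u₀ u₁ v₀ v₁)) :
    BddOn (initialEdges a u₁ b v₁) g :=
  (bddOn_strip ha.2 hb.2 hg).mono fun _ hz =>
    ⟨⟨⟨ha.1.trans hz.1.1.1, hz.1.1.2.le⟩, ⟨hb.1.trans hz.1.2.1, hz.1.2.2.le⟩⟩,
      hz.2.imp le_of_eq le_of_eq⟩

theorem bddOn_cornerlessRect (ha : a ∈ Ioo u₀ u₁) (hb : b ∈ Ioo v₀ v₁)
    (hg : ContinuousOn g (cornerlessRect u₀ u₁ v₀ v₁)) (hgb : BddOn (rect a u₁ b v₁) g) :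
    BddOn (cornerlessRect u₀ u₁ v₀ v₁) g := by
  obtain ⟨K, hK⟩ := bddOn_strip ha.2 hb.2 hg
  obtain ⟨L, hL⟩ := hgb
  refine ⟨max K L, fun z hz => ?_⟩
  by_cases hz' : z.1 ≤ a ∨ z.2 ≤ b
  · exact (hK z ⟨hz.1, hz'⟩).trans (le_max_left _ _)
  · push Not at hz'
    refine le_trans ?_ (le_max_right _ _)
    have hcl : z ∈ closure (rect a u₁ b v₁) := by
      rw [rect, closure_prod_eq, closure_Ico ha.2.ne, closure_Ico hb.2.ne]
      exact ⟨⟨hz'.1.le, hz.1.1.2⟩, ⟨hz'.2.le, hz.1.2.2⟩⟩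
    have hsub : rect a u₁ b v₁ ⊆ cornerlessRect u₀ u₁ v₀ v₁ := fun y hy =>
      mk_mem_cornerlessRect_of_fst ⟨ha.1.trans_le hy.1.1, hy.1.2⟩
        ⟨hb.1.le.trans hy.2.1, hy.2.2.le⟩
    exact ((hg z hz).mono hsub).abs.closure_le hcl continuousWithinAt_const hL

end Extension

end CornerlessRect

section ClassicalSolution

variable {r Ω φ : ℝ → ℝ → ℝ} {V : ℝ → ℝ} {u₀ u₁ v₀ v₁ a b : ℝ}

local notation "D" => cornerlessRect u₀ u₁ v₀ v₁

theorem fstDerivWithin_div_sq_of_eqC1 (hu : u₀ < u₁) (hv : v₀ < v₁)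
    (hr : ContDiffOn ℝ 2 (fun z => r z.1 z.2) D) (hΩ : ContDiffOn ℝ 2 (fun z => Ω z.1 z.2) D)
    {z : ℝ × ℝ} (hz : z ∈ Ioo u₀ u₁ ×ˢ Ioo v₀ v₁)
    (hΩz : Ω z.1 z.2 ≠ 0) (h : eqC1 r Ω φ z.1 z.2) :
    HasDerivAt (fun s => fstDerivWithin D (fun z => r z.1 z.2) (s, z.2) / Ω s z.2 ^ 2)
      (-(r z.1 z.2) * pu φ z.1 z.2 ^ 2 / Ω z.1 z.2 ^ 2) z.1 ∧
    fstDerivWithin D (fstDerivWithin D (fun z => r z.1 z.2)) z = -(r z.1 z.2) * pu φ z.1 z.2 ^ 2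
      + fstDerivWithin D (fun z => r z.1 z.2) z
        * (2 * fstDerivWithin D (fun z => Ω z.1 z.2) z / Ω z.1 z.2) := by
  have hz' : z ∈ Ioo u₀ u₁ ×ˢ Icc v₀ v₁ := ⟨hz.1, Ioo_subset_Icc_self hz.2⟩
  have hd := (hasDerivAt_fst
    ((contDiffOn_fstDerivWithin hu hv hr).differentiableOn one_ne_zero) hz').fun_div
    ((hasDerivAt_fst (hΩ.differentiableOn two_ne_zero) hz').fun_pow 2) (pow_ne_zero 2 hΩz)
  have heq : pu (fun a b => pu r a b / Ω a b ^ 2) z.1 z.2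
      = deriv (fun s => fstDerivWithin D (fun z => r z.1 z.2) (s, z.2) / Ω s z.2 ^ 2) z.1 := by
    refine Filter.EventuallyEq.deriv_eq
      (Filter.eventually_of_mem (Ioo_mem_nhds hz.1.1 hz.1.2) fun s hs => ?_)
    exact congrArg (· / Ω s z.2 ^ 2)
      (pu_eq_fstDerivWithin (z := (s, z.2)) (hr.differentiableOn two_ne_zero) ⟨hs, hz'.2⟩)
  have hval := hd.deriv.symm.trans (heq.symm.trans h)
  refine ⟨hd.congr_deriv hval, ?_⟩
  simp only [Prod.mk.eta] at hval
  field_simp at hval ⊢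
  push_cast at hval
  refine mul_left_cancel₀ hΩz ?_
  linear_combination hval

theorem sndDerivWithin_div_sq_of_eqC2 (hu : u₀ < u₁) (hv : v₀ < v₁)
    (hr : ContDiffOn ℝ 2 (fun z => r z.1 z.2) D) (hΩ : ContDiffOn ℝ 2 (fun z => Ω z.1 z.2) D)
    {z : ℝ × ℝ} (hz : z ∈ Ioo u₀ u₁ ×ˢ Ioo v₀ v₁)
    (hΩz : Ω z.1 z.2 ≠ 0) (h : eqC2 r Ω φ z.1 z.2) :
    HasDerivAt (fun s => sndDerivWithin D (fun z => r z.1 z.2) (z.1, s) / Ω z.1 s ^ 2)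
      (-(r z.1 z.2) * pv φ z.1 z.2 ^ 2 / Ω z.1 z.2 ^ 2) z.2 ∧
    sndDerivWithin D (sndDerivWithin D (fun z => r z.1 z.2)) z = -(r z.1 z.2) * pv φ z.1 z.2 ^ 2
      + sndDerivWithin D (fun z => r z.1 z.2) z
        * (2 * sndDerivWithin D (fun z => Ω z.1 z.2) z / Ω z.1 z.2) := by
  have hz' : z ∈ Icc u₀ u₁ ×ˢ Ioo v₀ v₁ := ⟨Ioo_subset_Icc_self hz.1, hz.2⟩
  have hd := (hasDerivAt_snd
    ((contDiffOn_sndDerivWithin hu hv hr).differentiableOn one_ne_zero) hz').fun_div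
    ((hasDerivAt_snd (hΩ.differentiableOn two_ne_zero) hz').fun_pow 2) (pow_ne_zero 2 hΩz)
  have heq : pv (fun a b => pv r a b / Ω a b ^ 2) z.1 z.2
      = deriv (fun s => sndDerivWithin D (fun z => r z.1 z.2) (z.1, s) / Ω z.1 s ^ 2) z.2 := by
    refine Filter.EventuallyEq.deriv_eq
      (Filter.eventually_of_mem (Ioo_mem_nhds hz.2.1 hz.2.2) fun s hs => ?_)
    exact congrArg (· / Ω z.1 s ^ 2)
      (pv_eq_sndDerivWithin (z := (z.1, s)) (hr.differentiableOn two_ne_zero) ⟨hz'.1, hs⟩)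
  have hval := hd.deriv.symm.trans (heq.symm.trans h)
  refine ⟨hd.congr_deriv hval, ?_⟩
  simp only [Prod.mk.eta] at hval
  field_simp at hval ⊢
  push_cast at hval
  refine mul_left_cancel₀ hΩz ?_
  linear_combination hval

theorem contDiffOn_log_sq (hΩ : ContDiffOn ℝ 2 (fun z => Ω z.1 z.2) D)
    (hpos : ∀ z ∈ D, 0 < Ω z.1 z.2) :
    ContDiffOn ℝ 2 (fun z => Real.log (Ω z.1 z.2 ^ 2)) D :=
  (hΩ.pow 2).log fun z hz => pow_ne_zero 2 (hpos z hz).ne'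

theorem fstDerivWithin_log_sq (hΩ : ContDiffOn ℝ 2 (fun z => Ω z.1 z.2) D)
    (hpos : ∀ z ∈ D, 0 < Ω z.1 z.2)
    {z : ℝ × ℝ} (hz : z ∈ Ioo u₀ u₁ ×ˢ Icc v₀ v₁) :
    fstDerivWithin D (fun z => Real.log (Ω z.1 z.2 ^ 2)) z
      = 2 * fstDerivWithin D (fun z => Ω z.1 z.2) z / Ω z.1 z.2 := by
  have hΩz := (hpos z (mk_mem_cornerlessRect_of_fst hz.1 hz.2)).ne'
  refine (hasDerivAt_fst ((contDiffOn_log_sq hΩ hpos).differentiableOn two_ne_zero) hz).unique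
    ((((hasDerivAt_fst (hΩ.differentiableOn two_ne_zero) hz).fun_pow 2).log
      (pow_ne_zero 2 hΩz)).congr_deriv ?_)
  field_simp
  push_cast
  ring

theorem sndDerivWithin_log_sq (hΩ : ContDiffOn ℝ 2 (fun z => Ω z.1 z.2) D)
    (hpos : ∀ z ∈ D, 0 < Ω z.1 z.2)
    {z : ℝ × ℝ} (hz : z ∈ Icc u₀ u₁ ×ˢ Ioo v₀ v₁) :
    sndDerivWithin D (fun z => Real.log (Ω z.1 z.2 ^ 2)) z
      = 2 * sndDerivWithin D (fun z => Ω z.1 z.2) z / Ω z.1 z.2 := by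
  have hΩz := (hpos z (mk_mem_cornerlessRect_of_snd hz.1 hz.2)).ne'
  refine (hasDerivAt_snd ((contDiffOn_log_sq hΩ hpos).differentiableOn two_ne_zero) hz).unique
    ((((hasDerivAt_snd (hΩ.differentiableOn two_ne_zero) hz).fun_pow 2).log
      (pow_ne_zero 2 hΩz)).congr_deriv ?_)
  field_simp
  push_cast
  ring

theorem mem_Ioo_prod_of_mem_rect (ha : a ∈ Ioo u₀ u₁) (hb : b ∈ Ioo v₀ v₁) {z : ℝ × ℝ}
    (hz : z ∈ rect a u₁ b v₁) : z ∈ Ioo u₀ u₁ ×ˢ Ioo v₀ v₁ :=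
  ⟨⟨ha.1.trans_le hz.1.1, hz.1.2⟩, ⟨hb.1.trans_le hz.2.1, hz.2.2⟩⟩

/-- Restricted to a rectangle with lower left corner in the interior, a solution is regular up to
the initial edges, all of whose bounds follow from compactness. -/
theorem isRegularSolution_of_eqs (ha : a ∈ Ioo u₀ u₁) (hb : b ∈ Ioo v₀ v₁)
    (hr : ContDiffOn ℝ 2 (fun z => r z.1 z.2) D)
    (hΩ : ContDiffOn ℝ 2 (fun z => Ω z.1 z.2) D) (hφ : ContDiffOn ℝ 2 (fun z => φ z.1 z.2) D)
    (hpt : ∀ p ∈ D, 0 < r p.1 p.2 ∧ 0 < Ω p.1 p.2 ∧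
      eqE1 r Ω φ V p.1 p.2 ∧ eqE2 r Ω φ p.1 p.2 ∧ eqE3 r Ω φ V p.1 p.2 ∧
      eqC1 r Ω φ p.1 p.2 ∧ eqC2 r Ω φ p.1 p.2 ∧ 0 ≤ pv r p.1 p.2 ∧ pu r p.1 p.2 < 0) :
    IsRegularSolution V a u₁ b v₁ (fun z => r z.1 z.2) (fstDerivWithin D (fun z => r z.1 z.2))
      (sndDerivWithin D (fun z => r z.1 z.2)) (fun z => Ω z.1 z.2 ^ 2) (fun z => φ z.1 z.2)
      (fstDerivWithin D (fun z => φ z.1 z.2)) (sndDerivWithin D (fun z => φ z.1 z.2))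
      (fstDerivWithin D (fun z => Real.log (Ω z.1 z.2 ^ 2)))
      (sndDerivWithin D (fun z => Real.log (Ω z.1 z.2 ^ 2))) := by
  have hu : u₀ < u₁ := ha.1.trans ha.2
  have hv : v₀ < v₁ := hb.1.trans hb.2
  have hpos : ∀ z ∈ D, 0 < Ω z.1 z.2 := fun z hz => (hpt z hz).2.1
  have hlog := contDiffOn_log_sq hΩ hpos
  have hr₁ := hr.differentiableOn two_ne_zero
  have hφ₁ := hφ.differentiableOn two_ne_zero
  have hI : ∀ z ∈ rect a u₁ b v₁, z ∈ Ioo u₀ u₁ ×ˢ Ioo v₀ v₁ :=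
    fun z => mem_Ioo_prod_of_mem_rect ha hb
  have hIu : ∀ z ∈ rect a u₁ b v₁, z ∈ Ioo u₀ u₁ ×ˢ Icc v₀ v₁ :=
    fun z hz => ⟨(hI z hz).1, Ioo_subset_Icc_self (hI z hz).2⟩
  have hIv : ∀ z ∈ rect a u₁ b v₁, z ∈ Icc u₀ u₁ ×ˢ Ioo v₀ v₁ :=
    fun z hz => ⟨Ioo_subset_Icc_self (hI z hz).1, (hI z hz).2⟩
  have hD : ∀ z ∈ rect a u₁ b v₁, z ∈ D :=
    fun z hz => mk_mem_cornerlessRect_of_fst (hIu z hz).1 (hIu z hz).2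
  have hE : ∀ {g : ℝ × ℝ → ℝ}, ContinuousOn g D → BddOn (initialEdges a u₁ b v₁) g :=
    bddOn_initialEdges ⟨ha.1.le, ha.2⟩ ⟨hb.1.le, hb.2⟩
  have hn : ∀ z ∈ D, fstDerivWithin D (fun z => r z.1 z.2) z < 0 := fun z hz => by
    have h := (hpt z hz).2.2.2.2.2.2.2.2
    exact pu_eq_fstDerivWithin_of_ne_zero hu hr₁ hz h.ne ▸ h
  have hcn := (contDiffOn_fstDerivWithin hu hv hr).continuousOn
  have hE1 : ∀ z ∈ rect a u₁ b v₁, pu (pv r) z.1 z.2 =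
      -(1 / r z.1 z.2) * fstDerivWithin D (fun z => r z.1 z.2) z
          * sndDerivWithin D (fun z => r z.1 z.2) z
        - Ω z.1 z.2 ^ 2 / (4 * r z.1 z.2) + r z.1 z.2 / 2 * Ω z.1 z.2 ^ 2 * V (φ z.1 z.2) :=
    fun z hz => by
      rw [← pu_eq_fstDerivWithin hr₁ (hIu z hz), ← pv_eq_sndDerivWithin hr₁ (hIv z hz)]
      exact (hpt z (hD z hz)).2.2.1
  have hE2 : ∀ z ∈ rect a u₁ b v₁, pu (pv fun a b => Real.log (Ω a b ^ 2)) z.1 z.2 =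
      Ω z.1 z.2 ^ 2 / (4 * r z.1 z.2 ^ 2)
        + fstDerivWithin D (fun z => r z.1 z.2) z
          * sndDerivWithin D (fun z => r z.1 z.2) z / r z.1 z.2 ^ 2
        - fstDerivWithin D (fun z => φ z.1 z.2) z
          * sndDerivWithin D (fun z => φ z.1 z.2) z := fun z hz => by
    rw [← pu_eq_fstDerivWithin hr₁ (hIu z hz), ← pv_eq_sndDerivWithin hr₁ (hIv z hz),
      ← pu_eq_fstDerivWithin hφ₁ (hIu z hz), ← pv_eq_sndDerivWithin hφ₁ (hIv z hz)]
    exact (hpt z (hD z hz)).2.2.2.1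
  have hE3 : ∀ z ∈ rect a u₁ b v₁, pu (pv φ) z.1 z.2 =
      -(fstDerivWithin D (fun z => φ z.1 z.2) z
          * sndDerivWithin D (fun z => r z.1 z.2) z) / r z.1 z.2
        - (sndDerivWithin D (fun z => φ z.1 z.2) z
          * fstDerivWithin D (fun z => r z.1 z.2) z) / r z.1 z.2
        - Ω z.1 z.2 ^ 2 / 4 * deriv V (φ z.1 z.2) := fun z hz => by
    rw [← pu_eq_fstDerivWithin hr₁ (hIu z hz), ← pv_eq_sndDerivWithin hr₁ (hIv z hz),
      ← pu_eq_fstDerivWithin hφ₁ (hIu z hz), ← pv_eq_sndDerivWithin hφ₁ (hIv z hz)]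
    exact (hpt z (hD z hz)).2.2.2.2.1
  exact
    { r_pos := fun z hz => (hpt z (hD z hz)).1
      w_pos := fun z hz => pow_pos (hpos z (hD z hz)) 2
      n_neg := fun z hz => hn z (hD z hz)
      l_nonneg := fun z hz => by
        rw [← pv_eq_sndDerivWithin hr₁ (hIv z hz)]
        exact (hpt z (hD z hz)).2.2.2.2.2.2.2.1
      r_fst := fun z hz => hasDerivAt_fst hr₁ (hIu z hz)
      r_snd := fun z hz => hasDerivAt_snd hr₁ (hIv z hz)
      φ_snd := fun z hz => hasDerivAt_snd hφ₁ (hIv z hz)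
      l_fst := fun z hz => hasDerivAt_fst_fst_of_pu_pv hu hv hr (hI z hz) (hE1 z hz)
      n_snd := fun z hz => hasDerivAt_snd_fst_of_pu_pv hu hv hr (hI z hz) (hE1 z hz)
      y_fst := fun z hz => hasDerivAt_fst_fst_of_pu_pv
        (f := fun a b => Real.log (Ω a b ^ 2)) hu hv hlog (hI z hz) (hE2 z hz)
      x_snd := fun z hz => hasDerivAt_snd_fst_of_pu_pv
        (f := fun a b => Real.log (Ω a b ^ 2)) hu hv hlog (hI z hz) (hE2 z hz)
      q_fst := fun z hz => hasDerivAt_fst_fst_of_pu_pv hu hv hφ (hI z hz) (hE3 z hz)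
      p_snd := fun z hz => hasDerivAt_snd_fst_of_pu_pv hu hv hφ (hI z hz) (hE3 z hz)
      nw_fst := fun z hz => by
        rw [← pu_eq_fstDerivWithin hφ₁ (hIu z hz)]
        exact (fstDerivWithin_div_sq_of_eqC1 hu hv hr hΩ (hI z hz) (hpos z (hD z hz)).ne'
          (hpt z (hD z hz)).2.2.2.2.2.1).1
      lw_snd := fun z hz => by
        rw [← pv_eq_sndDerivWithin hφ₁ (hIv z hz)]
        exact (sndDerivWithin_div_sq_of_eqC2 hu hv hr hΩ (hI z hz) (hpos z (hD z hz)).ne'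
          (hpt z (hD z hz)).2.2.2.2.2.2.1).1
      edge_r := hE hr.continuousOn
      edge_r_inv := hE (hr.continuousOn.inv₀ fun z hz => (hpt z hz).1.ne')
      edge_n := hE hcn
      edge_n_inv := hE (hcn.inv₀ fun z hz => (hn z hz).ne)
      edge_l := hE (contDiffOn_sndDerivWithin hu hv hr).continuousOn
      edge_w := hE (hΩ.continuousOn.pow 2)
      edge_w_inv := hE ((hΩ.continuousOn.pow 2).inv₀ fun z hz => (pow_pos (hpos z hz) 2).ne')
      edge_φ := hE hφ.continuousOn
      edge_p := hE (contDiffOn_fstDerivWithin hu hv hφ).continuousOn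
      edge_q := hE (contDiffOn_sndDerivWithin hu hv hφ).continuousOn
      edge_x := hE (contDiffOn_fstDerivWithin hu hv hlog).continuousOn
      edge_y := hE (contDiffOn_sndDerivWithin hu hv hlog).continuousOn }

theorem exists_bound_of_eqs {C : ℝ} (hu : u₀ < u₁) (hv : v₀ < v₁) (hV : ContDiff ℝ 1 V)
    (hVlb : ∀ x : ℝ, -C ≤ V x) (hr : ContDiffOn ℝ 2 (fun z => r z.1 z.2) D)
    (hΩ : ContDiffOn ℝ 2 (fun z => Ω z.1 z.2) D)
    (hφ : ContDiffOn ℝ 2 (fun z => φ z.1 z.2) D)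
    (hpt : ∀ p ∈ D, 0 < r p.1 p.2 ∧ 0 < Ω p.1 p.2 ∧
      eqE1 r Ω φ V p.1 p.2 ∧ eqE2 r Ω φ p.1 p.2 ∧ eqE3 r Ω φ V p.1 p.2 ∧
      eqC1 r Ω φ p.1 p.2 ∧ eqC2 r Ω φ p.1 p.2 ∧ 0 ≤ pv r p.1 p.2 ∧ pu r p.1 p.2 < 0) :
    ∃ S : ℝ, ∀ p : ℝ × ℝ, p ∈ D →
      |Ω p.1 p.2| + |(Ω p.1 p.2)⁻¹| + |pu Ω p.1 p.2| + |pv Ω p.1 p.2|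
        + r p.1 p.2 + (r p.1 p.2)⁻¹ + |pu r p.1 p.2| + |pv r p.1 p.2|
        + |pu (pu r) p.1 p.2| + |pv (pv r) p.1 p.2| + |pu (pv r) p.1 p.2|
        + |φ p.1 p.2| + |pu φ p.1 p.2| + |pv φ p.1 p.2| ≤ S := by
  obtain ⟨a, ha⟩ := nonempty_Ioo.2 hu
  obtain ⟨b, hb⟩ := nonempty_Ioo.2 hv
  have hsol := isRegularSolution_of_eqs ha hb hr hΩ hφ hpt
  have hpos : ∀ z ∈ D, 0 < Ω z.1 z.2 := fun z hz => (hpt z hz).2.1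
  have hr₁ := hr.differentiableOn two_ne_zero
  have hΩ₁ := hΩ.differentiableOn two_ne_zero
  have hφ₁ := hφ.differentiableOn two_ne_zero
  have hVd : Continuous (deriv V) := hV.continuous_deriv le_rfl
  have hI : ∀ z ∈ rect a u₁ b v₁, z ∈ Ioo u₀ u₁ ×ˢ Ioo v₀ v₁ :=
    fun z => mem_Ioo_prod_of_mem_rect ha hb
  have hIu : ∀ z ∈ rect a u₁ b v₁, z ∈ Ioo u₀ u₁ ×ˢ Icc v₀ v₁ :=
    fun z hz => ⟨(hI z hz).1, Ioo_subset_Icc_self (hI z hz).2⟩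
  have hIv : ∀ z ∈ rect a u₁ b v₁, z ∈ Icc u₀ u₁ ×ˢ Ioo v₀ v₁ :=
    fun z hz => ⟨Ioo_subset_Icc_self (hI z hz).1, (hI z hz).2⟩
  have hD : ∀ z ∈ rect a u₁ b v₁, z ∈ D :=
    fun z hz => mk_mem_cornerlessRect_of_fst (hIu z hz).1 (hIu z hz).2
  have hext : ∀ {g : ℝ × ℝ → ℝ}, ContinuousOn g D → BddOn (rect a u₁ b v₁) g → BddOn D g :=
    bddOn_cornerlessRect ha hb
  -- bounds on the interior rectangle
  have bn := hsol.bddOn_n hVlb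
  have bl := hsol.bddOn_l hVlb
  have bp := hsol.bddOn_p hVlb hVd
  have bq := hsol.bddOn_q hVlb hVd
  obtain ⟨bx, byy⟩ := hsol.bddOn_log_deriv hVlb hVd
  have bΩ := (hsol.bddOn_w hVlb).of_sq
  have bΩi := ((hsol.bddOn_w_inv hVlb hV.continuous hVd).congr
    (g := fun z => ((Ω z.1 z.2)⁻¹) ^ 2) fun z _ => inv_pow _ _).of_sq
  have bΩu : BddOn (rect a u₁ b v₁) (fstDerivWithin D fun z => Ω z.1 z.2) :=
    ((bΩ.mul bx).mul (.const 2⁻¹)).congr fun z hz => by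
      have := (hpos z (hD z hz)).ne'
      rw [fstDerivWithin_log_sq hΩ hpos (hIu z hz)]
      field_simp
  have bΩv : BddOn (rect a u₁ b v₁) (sndDerivWithin D fun z => Ω z.1 z.2) :=
    ((bΩ.mul byy).mul (.const 2⁻¹)).congr fun z hz => by
      have := (hpos z (hD z hz)).ne'
      rw [sndDerivWithin_log_sq hΩ hpos (hIv z hz)]
      field_simp
  have bnu : BddOn (rect a u₁ b v₁) (fstDerivWithin D (fstDerivWithin D fun z => r z.1 z.2)) :=
    ((hsol.bddOn_r.neg.mul (bp.pow 2)).add (bn.mul bx)).congr fun z hz => by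
      rw [fstDerivWithin_log_sq hΩ hpos (hIu z hz), ← pu_eq_fstDerivWithin hφ₁ (hIu z hz)]
      exact (fstDerivWithin_div_sq_of_eqC1 hu hv hr hΩ (hI z hz) (hpos z (hD z hz)).ne'
        (hpt z (hD z hz)).2.2.2.2.2.1).2
  have blv : BddOn (rect a u₁ b v₁) (sndDerivWithin D (sndDerivWithin D fun z => r z.1 z.2)) :=
    ((hsol.bddOn_r.neg.mul (bq.pow 2)).add (bl.mul byy)).congr fun z hz => by
      rw [sndDerivWithin_log_sq hΩ hpos (hIv z hz), ← pv_eq_sndDerivWithin hφ₁ (hIv z hz)]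
      exact (sndDerivWithin_div_sq_of_eqC2 hu hv hr hΩ (hI z hz) (hpos z (hD z hz)).ne'
        (hpt z (hD z hz)).2.2.2.2.2.2.1).2
  -- extension to the whole domain
  have dr := hext hr.continuousOn hsol.bddOn_r
  have dri := hext (hr.continuousOn.inv₀ fun z hz => (hpt z hz).1.ne') hsol.bddOn_r_inv
  have dΩ := hext hΩ.continuousOn bΩ
  have dΩi := hext (hΩ.continuousOn.inv₀ fun z hz => (hpos z hz).ne') bΩi
  have dφ := hext hφ.continuousOn (hsol.bddOn_φ hVlb)
  have dΩu := (hext (contDiffOn_fstDerivWithin hu hv hΩ).continuousOn bΩu).mono_abs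
    (g := fun z => pu Ω z.1 z.2) fun z hz => abs_pu_le hu hΩ₁ hz
  have dΩv := (hext (contDiffOn_sndDerivWithin hu hv hΩ).continuousOn bΩv).mono_abs
    (g := fun z => pv Ω z.1 z.2) fun z hz => abs_pv_le hv hΩ₁ hz
  have dru := (hext (contDiffOn_fstDerivWithin hu hv hr).continuousOn bn).mono_abs
    (g := fun z => pu r z.1 z.2) fun z hz => abs_pu_le hu hr₁ hz
  have drv := (hext (contDiffOn_sndDerivWithin hu hv hr).continuousOn bl).mono_abs
    (g := fun z => pv r z.1 z.2) fun z hz => abs_pv_le hv hr₁ hz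
  have dφu := (hext (contDiffOn_fstDerivWithin hu hv hφ).continuousOn bp).mono_abs
    (g := fun z => pu φ z.1 z.2) fun z hz => abs_pu_le hu hφ₁ hz
  have dφv := (hext (contDiffOn_sndDerivWithin hu hv hφ).continuousOn bq).mono_abs
    (g := fun z => pv φ z.1 z.2) fun z hz => abs_pv_le hv hφ₁ hz
  have druu := (hext (continuousOn_fstDerivWithin hu hv (contDiffOn_fstDerivWithin hu hv hr))
    bnu).mono_abs (g := fun z => pu (pu r) z.1 z.2) fun z hz => abs_pu_pu_le hu hv hr hz
  have drvv := (hext (continuousOn_sndDerivWithin hu hv (contDiffOn_sndDerivWithin hu hv hr))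
    blv).mono_abs (g := fun z => pv (pv r) z.1 z.2) fun z hz => abs_pv_pv_le hu hv hr hz
  have druv : BddOn D fun z => pu (pv r) z.1 z.2 := by
    refine ((((dri.mul dru).mul drv).neg.sub (((dΩ.pow 2).mul (.const 4⁻¹)).mul dri)).add
      (((dr.mul (.const 2⁻¹)).mul (dΩ.pow 2)).mul (dφ.comp_continuous hV.continuous))).congr
      fun z hz => ?_
    have hE1 : pu (pv r) z.1 z.2 = _ := (hpt z hz).2.2.1
    rw [hE1]
    have := (hpt z hz).1.ne'
    simp only [Pi.inv_apply]
    field_simp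
  exact (((((((((((((dΩ.abs.add dΩi.abs).add dΩu.abs).add dΩv.abs).add dr).add dri).add
    dru.abs).add drv.abs).add druu.abs).add drvv.abs).add druv.abs).add dφ.abs).add
    dφu.abs).add dφv.abs).exists_le

end ClassicalSolution

/-- a priori C² bounds on D = [u₀,u₁]×[v₀,v₁] \ {(u₁,v₁)} from bounds on
the initial edges X = ({u₀}×[v₀,v₁]) ∪ ([u₀,u₁]×{v₀}). -/
theorem apriori_bounds (r Ω φ : ℝ → ℝ → ℝ) (V : ℝ → ℝ) (u₀ u₁ v₀ v₁ C : ℝ)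
    (hu : u₀ < u₁) (hv : v₀ < v₁) (hC : 0 ≤ C)
    (hV : ContDiff ℝ 1 V) (hVlb : ∀ x : ℝ, -C ≤ V x)
    (hr : ContDiffOn ℝ 2 (fun p : ℝ × ℝ => r p.1 p.2)
      (Set.Icc u₀ u₁ ×ˢ Set.Icc v₀ v₁ \ {(u₁, v₁)}))
    (hΩ : ContDiffOn ℝ 2 (fun p : ℝ × ℝ => Ω p.1 p.2)
      (Set.Icc u₀ u₁ ×ˢ Set.Icc v₀ v₁ \ {(u₁, v₁)}))
    (hφ : ContDiffOn ℝ 2 (fun p : ℝ × ℝ => φ p.1 p.2)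
      (Set.Icc u₀ u₁ ×ˢ Set.Icc v₀ v₁ \ {(u₁, v₁)}))
    (hpt : ∀ p : ℝ × ℝ, p ∈ Set.Icc u₀ u₁ ×ˢ Set.Icc v₀ v₁ \ {(u₁, v₁)} →
      0 < r p.1 p.2 ∧ 0 < Ω p.1 p.2 ∧
      eqE1 r Ω φ V p.1 p.2 ∧ eqE2 r Ω φ p.1 p.2 ∧ eqE3 r Ω φ V p.1 p.2 ∧
      eqC1 r Ω φ p.1 p.2 ∧ eqC2 r Ω φ p.1 p.2 ∧
      0 ≤ pv r p.1 p.2 ∧ pu r p.1 p.2 < 0)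
    (hX : ∃ B : ℝ, ∀ p : ℝ × ℝ,
      p ∈ ({u₀} : Set ℝ) ×ˢ Set.Icc v₀ v₁ ∪ Set.Icc u₀ u₁ ×ˢ ({v₀} : Set ℝ) →
      r p.1 p.2 ≤ B ∧ (r p.1 p.2)⁻¹ ≤ B ∧
      |pu r p.1 p.2| ≤ B ∧ pv r p.1 p.2 ≤ B ∧
      |φ p.1 p.2| ≤ B ∧
      |r p.1 p.2 * pv φ p.1 p.2| ≤ B ∧ |r p.1 p.2 * pu φ p.1 p.2| ≤ B ∧
      |hawkingMass r Ω p.1 p.2| ≤ B ∧ kappa r Ω p.1 p.2 ≤ B ∧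
      |pu Ω p.1 p.2| ≤ B ∧ |pv Ω p.1 p.2| ≤ B ∧
      |pu (pu r) p.1 p.2| ≤ B ∧ |pv (pv r) p.1 p.2| ≤ B) :
    ∃ S : ℝ, ∀ p : ℝ × ℝ, p ∈ Set.Icc u₀ u₁ ×ˢ Set.Icc v₀ v₁ \ {(u₁, v₁)} →
      |Ω p.1 p.2| + |(Ω p.1 p.2)⁻¹| + |pu Ω p.1 p.2| + |pv Ω p.1 p.2|
        + r p.1 p.2 + (r p.1 p.2)⁻¹ + |pu r p.1 p.2| + |pv r p.1 p.2|
        + |pu (pu r) p.1 p.2| + |pv (pv r) p.1 p.2| + |pu (pv r) p.1 p.2|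
        + |φ p.1 p.2| + |pu φ p.1 p.2| + |pv φ p.1 p.2| ≤ S :=
  exists_bound_of_eqs hu hv hV hVlb hr hΩ hφ hpt
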